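/- Convergence is not guaranteed for X = ℝ^3 with the ℓ∞ metric and the element-wise median rule. Concretely, with n = 4 agents and ε = 1, define v_0^0 = (0,0,0), v_1^0 = (−2,0,0), v_2^0 = (0,−2,0), v_3^0 = (0,0,−2), and for every j ≥ 0: v_0^{j+1} = (j, j, j), v_1^{j+1} = (−1+j, 1+j, 1+j), v_2^{j+1} = (1+j, −1+j, 1+j), v_3^{j+1} = (1+j, 1+j, −1+j). Then the winner at every iteration is w^j = (j, j, j); the sequences satisfy the deliberation constraints (C1) and (C2); and the process never converges, since v_1^{j+1} ≠ v_1^j for every j. -/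

import Mathlib

/-- A deliberation process: at each iteration `j`, every agent `i` moves from `V j i`
to `V (j+1) i`, subject to constraints (C1) and (C2) with respect to the current
winner `R (V j)` and step size `ε`. -/
def DelibProcess {X : Type*} {n : ℕ} (d : X → X → ℝ) (R : (Fin n → X) → X) (ε : ℝ)
    (V : ℕ → Fin n → X) : Prop :=
  ∀ (i : Fin n) (j : ℕ),
    d (V (j + 1) i) (R (V j)) = max 0 (d (V j i) (R (V j)) - ε) ∧
    (0 < d (V (j + 1) i) (R (V j)) → d (V (j + 1) i) (V j i) = ε) ∧
    (d (V (j + 1) i) (R (V j)) = 0 → d (V (j + 1) i) (V j i) ≤ ε)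

/-- The process converges: from some iteration on, the profile never changes. -/
def Converges {X : Type*} {n : ℕ} (V : ℕ → Fin n → X) : Prop :=
  ∃ N : ℕ, ∀ j : ℕ, N ≤ j → V j = V N
/-- The ℓ∞ distance on ℝ^3. -/
def linfdist (x y : Fin 3 → ℝ) : ℝ :=
  max |x 0 - y 0| (max |x 1 - y 1| |x 2 - y 2|)

/-- The median of n real numbers: the middle value in sorted (ascending) order, where
for an even number of values we take the larger of the two middle values; i.e., the
value at 0-indexed position ⌊n/2⌋ of the ascending sorted list. -/
noncomputable def medianVal {n : ℕ} (f : Fin n → ℝ) : ℝ :=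
  ((Multiset.ofList (List.ofFn f)).sort (· ≤ ·)).getD (n / 2) 0

/-- The element-wise median rule on ℝ^3 for 4 agents. -/
noncomputable def medianRule (V : Fin 4 → Fin 3 → ℝ) : Fin 3 → ℝ :=
  fun t => medianVal (fun i : Fin 4 => V i t)

/-- The median can be read off any ascending rearrangement of the values. -/
lemma medianVal_eq_getD {n : ℕ} {f : Fin n → ℝ} {l : List ℝ} (hp : (List.ofFn f).Perm l)
    (hl : l.Pairwise (· ≤ ·)) : medianVal f = l.getD (n / 2) 0 := by
  have h : (Multiset.ofList (List.ofFn f)).sort (· ≤ ·) = l := by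
    refine List.Perm.eq_of_pairwise' (r := (· ≤ ·)) (Multiset.pairwise_sort _ _) hl ?_
    rw [← Multiset.coe_eq_coe, Multiset.sort_eq]
    exact Multiset.coe_eq_coe.2 hp
  rw [medianVal, h]

/-- If one of four values is at most `b`, another at most `c`, and the last two equal `c`,
in some arrangement, the median is `c`. -/
lemma medianVal_four {f : Fin 4 → ℝ} {a b c : ℝ} (hab : a ≤ b) (hbc : b ≤ c)
    (hp : (List.ofFn f).Perm [a, b, c, c]) : medianVal f = c := by
  rw [medianVal_eq_getD hp (by simp [hab, hbc, hab.trans hbc])]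
  simp

/-- Non-convergence for ℝ^3 with the ℓ∞ metric and the element-wise median rule:
with 4 agents and ε = 1, the explicitly given trajectories have winner (j,j,j) at
every iteration j, the deliberation constraints (C1) and (C2) hold, agent 1 moves at
every iteration, and the process never converges. -/
theorem stmt13 (V : ℕ → Fin 4 → (Fin 3 → ℝ))
    (hV0 : V 0 =
      ![![(0 : ℝ), 0, 0], ![(-2 : ℝ), 0, 0], ![(0 : ℝ), -2, 0], ![(0 : ℝ), 0, -2]])
    (hV : ∀ j : ℕ, V (j + 1) =
      ![![(j : ℝ), j, j],
        ![(-1 : ℝ) + j, 1 + j, 1 + j],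
        ![(1 : ℝ) + j, -1 + j, 1 + j],
        ![(1 : ℝ) + j, 1 + j, -1 + j]]) :
    (∀ j : ℕ, medianRule (V j) = fun _ => (j : ℝ)) ∧
    DelibProcess linfdist medianRule 1 V ∧
    (∀ j : ℕ, V (j + 1) 1 ≠ V j 1) ∧
    ¬ Converges V := by
  have hw : ∀ j : ℕ, medianRule (V j) = fun _ => (j : ℝ) := by
    rintro (_ | j) <;> funext t
    · refine medianVal_four (a := -2) (b := 0) (by norm_num) (by simp) ?_
      rw [hV0, ← Multiset.coe_eq_coe]
      fin_cases t <;> simp [List.ofFn_succ, ← Multiset.cons_coe, ← Multiset.singleton_add] <;> abel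
    · refine medianVal_four (a := -1 + j) (b := j) (c := (j + 1 : ℕ)) (by linarith) (by simp) ?_
      rw [hV, ← Multiset.coe_eq_coe]
      fin_cases t <;>
        simp [List.ofFn_succ, ← Multiset.cons_coe, ← Multiset.singleton_add, add_comm (1 : ℝ)] <;>
        abel
  have hmove : ∀ j : ℕ, V (j + 1) 1 ≠ V j 1 := by
    rintro (_ | j) h <;> have h0 := congrFun h 0
    · norm_num [hV, hV0] at h0
    · norm_num [hV] at h0
  refine ⟨hw, ?_, hmove, ?_⟩
  · rintro i (_ | j) <;> rw [hw]
    · rw [hV, hV0]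
      fin_cases i <;> simp [linfdist] <;> norm_num
    · rw [hV, hV]
      fin_cases i <;> simp [linfdist] <;> ring_nf <;> norm_num
  · rintro ⟨N, hN⟩
    exact hmove N (congrFun (hN (N + 1) N.le_succ) 1)
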